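/- Let P ∈ ℝ^{N×N} be symmetric positive definite, ρ ∈ (0,1), σ ≥ 0, and let z^k, z^{k,⋆} ∈ ℝ^N (k ≥ 1) be sequences satisfying ‖z^{k+1} − z^{k,⋆}‖_P ≤ ρ·‖z^k − z^{k,⋆}‖_P for all k ≥ 1 and ‖z^{k,⋆} − z^{k−1,⋆}‖_P ≤ σ for all k ≥ 2. Suppose further that x^k, x^{k,⋆} ∈ ℝ^d are vectors with ‖x^k − x^{k,⋆}‖ ≤ ‖z^{k+1} − z^{k,⋆}‖ for all k ≥ 1 (as holds when x^k and x^{k,⋆} are corresponding sub-blocks of z^{k+1} and z^{k,⋆}). Then for all k ≥ 1, ‖x^k − x^{k,⋆}‖ ≤ (ρ^k/√(λ_min(P)))·‖z^1 − z^{1,⋆}‖_P + σρ(1 − ρ^{k−1})/(√(λ_min(P))·(1 − ρ)). -/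

import Mathlib

open Matrix Finset

/-- The `P`-norm `‖v‖_P = √(vᵀ P v)`. -/
noncomputable def Pnorm {ι : Type*} [Fintype ι] (P : Matrix ι ι ℝ) (v : ι → ℝ) : ℝ :=
  Real.sqrt (v ⬝ᵥ P.mulVec v)

/-- The Euclidean norm of a finitely supported real vector. -/
noncomputable def vnorm {ι : Type*} [Fintype ι] (v : ι → ℝ) : ℝ :=
  Real.sqrt (v ⬝ᵥ v)

/-- Smallest eigenvalue of a hermitian (real symmetric) matrix. -/
noncomputable def lamMin {ι : Type*} [Fintype ι] [DecidableEq ι]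
    (P : Matrix ι ι ℝ) (hP : P.IsHermitian) : ℝ := ⨅ i, hP.eigenvalues i

/-- Largest eigenvalue of a hermitian (real symmetric) matrix. -/
noncomputable def lamMax {ι : Type*} [Fintype ι] [DecidableEq ι]
    (P : Matrix ι ι ℝ) (hP : P.IsHermitian) : ℝ := ⨆ i, hP.eigenvalues i

section PnormLemmas

variable {ι : Type*} [Fintype ι]

lemma vnorm_eq_norm (v : ι → ℝ) : vnorm v = ‖WithLp.toLp 2 v‖ := by
  simp [vnorm, EuclideanSpace.norm_eq, dotProduct, sq]

lemma exists_Pnorm_eq_vnorm [DecidableEq ι] {P : Matrix ι ι ℝ} (hP : P.PosSemidef) :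
    ∃ B : Matrix ι ι ℝ, ∀ v, Pnorm P v = vnorm (B *ᵥ v) := by
  open scoped MatrixOrder in
  obtain ⟨B, hB⟩ := CStarAlgebra.nonneg_iff_eq_star_mul_self.mp hP.nonneg
  refine ⟨B, fun v => ?_⟩
  rw [Pnorm, vnorm, hB, star_eq_conjTranspose, conjTranspose_eq_transpose_of_trivial,
    ← mulVec_mulVec, dotProduct_mulVec, vecMul_transpose]

lemma Pnorm_add_le {P : Matrix ι ι ℝ} (hP : P.PosSemidef) (u v : ι → ℝ) :
    Pnorm P (u + v) ≤ Pnorm P u + Pnorm P v := by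
  classical
  obtain ⟨B, hB⟩ := exists_Pnorm_eq_vnorm hP
  simpa only [hB, mulVec_add, vnorm_eq_norm, WithLp.toLp_add] using norm_add_le _ _

lemma Pnorm_neg (P : Matrix ι ι ℝ) (v : ι → ℝ) : Pnorm P (-v) = Pnorm P v := by
  simp [Pnorm, mulVec_neg]

lemma lamMin_mul_dotProduct_le [DecidableEq ι] {P : Matrix ι ι ℝ} (hP : P.IsHermitian)
    (v : ι → ℝ) : lamMin P hP * (v ⬝ᵥ v) ≤ v ⬝ᵥ P *ᵥ v := by
  open scoped MatrixOrder in
  have h : algebraMap ℝ (Matrix ι ι ℝ) (lamMin P hP) ≤ P := by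
    refine (algebraMap_le_iff_le_spectrum (ha := hP)).mpr fun x hx => ?_
    rw [hP.spectrum_real_eq_range_eigenvalues] at hx
    obtain ⟨i, rfl⟩ := hx
    exact ciInf_le (Set.finite_range _).bddBelow i
  have := (Matrix.le_iff.mp h).dotProduct_mulVec_nonneg v
  simpa [sub_mulVec, Algebra.algebraMap_eq_smul_one, smul_mulVec, dotProduct_sub] using this

lemma lamMin_pos [DecidableEq ι] [Nonempty ι] {P : Matrix ι ι ℝ} (hP : P.PosDef) :
    0 < lamMin P hP.1 := by
  obtain ⟨i, hi⟩ := exists_eq_ciInf_of_finite (f := hP.1.eigenvalues)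
  rw [lamMin, ← hi]
  exact hP.eigenvalues_pos i

/-- When `ι` is empty, `lamMin` takes the junk value `0` and both sides vanish. -/
lemma vnorm_le_Pnorm_div_sqrt_lamMin [DecidableEq ι] {P : Matrix ι ι ℝ} (hP : P.PosDef)
    (v : ι → ℝ) : vnorm v ≤ Pnorm P v / Real.sqrt (lamMin P hP.1) := by
  cases isEmpty_or_nonempty ι
  · simp [vnorm, Pnorm, dotProduct]
  · have hpos := lamMin_pos hP
    rw [le_div_iff₀ (Real.sqrt_pos.mpr hpos), mul_comm, vnorm, Pnorm, ← Real.sqrt_mul hpos.le]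
    exact Real.sqrt_le_sqrt (lamMin_mul_dotProduct_le hP.1 v)

end PnormLemmas

lemma le_geometric_of_le_mul_add {ρ σ : ℝ} (hρ0 : 0 ≤ ρ) (hρ1 : ρ ≠ 1) {b : ℕ → ℝ}
    (hb : ∀ n, b (n + 1) ≤ ρ * (b n + σ)) (n : ℕ) :
    b n ≤ ρ ^ n * b 0 + σ * ρ * (1 - ρ ^ n) / (1 - ρ) := by
  have h1 : 1 - ρ ≠ 0 := sub_ne_zero.mpr hρ1.symm
  induction n with
  | zero => simp
  | succ n ih =>
    calc b (n + 1) ≤ ρ * (b n + σ) := hb n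
      _ ≤ ρ * (ρ ^ n * b 0 + σ * ρ * (1 - ρ ^ n) / (1 - ρ) + σ) := by gcongr
      _ = ρ ^ (n + 1) * b 0 + σ * ρ * (1 - ρ ^ (n + 1)) / (1 - ρ) := by
        field_simp
        ring

/-- **Iterate distance bound (eq. (38), proof of Corollary 2).** If additionally
`‖x^k - x^{k,⋆}‖ ≤ ‖z^{k+1} - z^{k,⋆}‖`, then
`‖x^k - x^{k,⋆}‖ ≤ (ρ^k/√λ_min(P))·‖z^1 - z^{1,⋆}‖_P + σρ(1 - ρ^{k-1})/(√λ_min(P)(1 - ρ))`. -/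
theorem iterate_distance_bound {N d : ℕ}
    (P : Matrix (Fin N) (Fin N) ℝ) (hP : P.PosDef)
    (ρ σ : ℝ) (hρ0 : 0 < ρ) (hρ1 : ρ < 1) (hσ : 0 ≤ σ)
    (z zs : ℕ → Fin N → ℝ) (x xs : ℕ → Fin d → ℝ)
    (hcontract : ∀ k ≥ 1, Pnorm P (z (k + 1) - zs k) ≤ ρ * Pnorm P (z k - zs k))
    (hvar : ∀ k ≥ 2, Pnorm P (zs k - zs (k - 1)) ≤ σ)
    (hsub : ∀ k ≥ 1, vnorm (x k - xs k) ≤ vnorm (z (k + 1) - zs k)) :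
    ∀ k ≥ 1, vnorm (x k - xs k) ≤
      ρ ^ k / Real.sqrt (lamMin P hP.1) * Pnorm P (z 1 - zs 1)
        + σ * ρ * (1 - ρ ^ (k - 1)) / (Real.sqrt (lamMin P hP.1) * (1 - ρ)) := by
  intro k hk
  obtain ⟨n, rfl⟩ := Nat.exists_eq_add_of_le' hk
  have hstep (n : ℕ) : Pnorm P (z (n + 1 + 1 + 1) - zs (n + 1 + 1)) ≤
      ρ * (Pnorm P (z (n + 1 + 1) - zs (n + 1)) + σ) := by
    refine (hcontract (n + 1 + 1) (by omega)).trans ?_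
    gcongr
    calc Pnorm P (z (n + 1 + 1) - zs (n + 1 + 1))
        = Pnorm P ((z (n + 1 + 1) - zs (n + 1)) + -(zs (n + 1 + 1) - zs (n + 1))) := by
          congr 1
          abel
      _ ≤ Pnorm P (z (n + 1 + 1) - zs (n + 1)) + Pnorm P (zs (n + 1 + 1) - zs (n + 1)) := by
          rw [← Pnorm_neg P (zs (n + 1 + 1) - zs (n + 1))]
          exact Pnorm_add_le hP.posSemidef _ _
      _ ≤ Pnorm P (z (n + 1 + 1) - zs (n + 1)) + σ := by
          gcongr
          exact hvar (n + 1 + 1) (by omega)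
  have hbound : Pnorm P (z (n + 1 + 1) - zs (n + 1)) ≤
      ρ ^ (n + 1) * Pnorm P (z 1 - zs 1) + σ * ρ * (1 - ρ ^ n) / (1 - ρ) := by
    refine (le_geometric_of_le_mul_add hρ0.le hρ1.ne
      (b := fun n => Pnorm P (z (n + 1 + 1) - zs (n + 1))) hstep n).trans ?_
    rw [pow_succ, mul_assoc (ρ ^ n)]
    gcongr
    exact hcontract 1 le_rfl
  calc vnorm (x (n + 1) - xs (n + 1))
      ≤ Pnorm P (z (n + 1 + 1) - zs (n + 1)) / Real.sqrt (lamMin P hP.1) :=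
        (hsub (n + 1) hk).trans (vnorm_le_Pnorm_div_sqrt_lamMin hP _)
    _ ≤ (ρ ^ (n + 1) * Pnorm P (z 1 - zs 1) + σ * ρ * (1 - ρ ^ n) / (1 - ρ)) /
          Real.sqrt (lamMin P hP.1) := by gcongr
    _ = _ := by
        rw [Nat.add_sub_cancel, add_div, div_div, mul_comm (1 - ρ), mul_div_right_comm]
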